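/- Let ρ : B_b → [0,1] be a default risk measure. Then the following are equivalent: (i) ρ(X) = ρ(𝟙_{X>0}) for all X ∈ B_b; (ii) ρ is scaling invariant and ρ(X) = ρ(X⁺) = inf_{ε>0} ρ(X + ε·𝟙_{X>0}) for all X ∈ B_b, where X⁺ := X·𝟙_{X>0}; (iii) ρ is liquidity invariant and illiquidity invariant. -/

import Mathlib

open MeasureTheory Filter Topology

/-- The set of bounded measurable functions `Ω → ℝ`. -/
def Bb (Ω : Type*) [MeasurableSpace Ω] : Set (Ω → ℝ) :=
  {X | Measurable X ∧ ∃ M : ℝ, ∀ ω, |X ω| ≤ M}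

/-- A default risk measure on a set `C` of bounded measurable functions:
it takes values in `[0,1]` on `C`, is monotone on `C`, vanishes at `0`,
and equals `1` on positive constants. -/
def IsDefaultRiskMeasure {Ω : Type*} [MeasurableSpace Ω]
    (C : Set (Ω → ℝ)) (ρ : (Ω → ℝ) → ℝ) : Prop :=
  (∀ X ∈ C, ρ X ∈ Set.Icc (0 : ℝ) 1) ∧
  (∀ X ∈ C, ∀ Y ∈ C, (∀ ω, X ω ≤ Y ω) → ρ X ≤ ρ Y) ∧
  ρ (fun _ => 0) = 0 ∧
  (∀ m : ℝ, 0 < m → ρ (fun _ => m) = 1)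

/-- A monetary risk measure on `Bb Ω`: monotone, normalized, cash additive. -/
def IsMonetaryRiskMeasure {Ω : Type*} [MeasurableSpace Ω] (R : (Ω → ℝ) → ℝ) : Prop :=
  (∀ X ∈ Bb Ω, ∀ Y ∈ Bb Ω, (∀ ω, X ω ≤ Y ω) → R X ≤ R Y) ∧
  R (fun _ => 0) = 0 ∧
  (∀ X ∈ Bb Ω, ∀ m : ℝ, R (fun ω => X ω + m) = R X + m)

/-- The `ρ`-value at risk at level `α`. -/
noncomputable def VaR {Ω : Type*} [MeasurableSpace Ω]
    (ρ : (Ω → ℝ) → ℝ) (α : ℝ) (X : Ω → ℝ) : ℝ :=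
  sInf {m : ℝ | ρ (fun ω => X ω - m) ≤ α}

/-- The indicator function of the default set `{X > 0}`. -/
noncomputable def indPos {Ω : Type*} (X : Ω → ℝ) : Ω → ℝ :=
  Set.indicator {ω | 0 < X ω} (fun _ => 1)

lemma indPos_of_pos {Ω : Type*} {X : Ω → ℝ} {ω : Ω} (h : 0 < X ω) : indPos X ω = 1 :=
  Set.indicator_of_mem (s := {ω | 0 < X ω}) h _

lemma indPos_of_nonpos {Ω : Type*} {X : Ω → ℝ} {ω : Ω} (h : X ω ≤ 0) : indPos X ω = 0 :=
  Set.indicator_of_notMem (s := {ω | 0 < X ω}) (not_lt.mpr h) _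

lemma indPos_nonneg {Ω : Type*} (X : Ω → ℝ) (ω : Ω) : 0 ≤ indPos X ω :=
  Set.indicator_nonneg (fun _ _ => zero_le_one) ω

lemma indPos_congr {Ω : Type*} {X Y : Ω → ℝ} (h : ∀ ω, 0 < X ω ↔ 0 < Y ω) :
    indPos X = indPos Y := by
  simp only [indPos, h]

lemma indPos_indPos {Ω : Type*} (X : Ω → ℝ) : indPos (indPos X) = indPos X :=
  indPos_congr fun ω => by
    rcases lt_or_ge 0 (X ω) with h | h
    · simp [indPos_of_pos h, h]
    · simp [indPos_of_nonpos h, h]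

lemma indPos_const_mul {Ω : Type*} (X : Ω → ℝ) {l : ℝ} (hl : 0 < l) :
    indPos (fun ω => l * X ω) = indPos X :=
  indPos_congr fun _ => mul_pos_iff_of_pos_left hl

lemma indPos_mul_indPos {Ω : Type*} (X : Ω → ℝ) :
    indPos (fun ω => X ω * indPos X ω) = indPos X :=
  indPos_congr fun ω => by
    rcases lt_or_ge 0 (X ω) with h | h
    · simp [indPos_of_pos h]
    · simp [indPos_of_nonpos h, h]

lemma indPos_add_mul_indPos {Ω : Type*} (X : Ω → ℝ) {m : ℝ} (hm : 0 < m) :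
    indPos (fun ω => X ω + m * indPos X ω) = indPos X :=
  indPos_congr fun ω => by
    rcases lt_or_ge 0 (X ω) with h | h
    · simp [indPos_of_pos h, h, add_pos h hm]
    · simp [indPos_of_nonpos h]

lemma indPos_sub_indicator_zero {Ω : Type*} (X : Ω → ℝ) {m : ℝ} (hm : 0 < m) :
    indPos (fun ω => X ω - m * Set.indicator {ω' | X ω' = 0} (fun _ => 1) ω) = indPos X :=
  indPos_congr fun ω => by
    by_cases h : X ω = 0
    · simp [h, hm.le]
    · simp [h]

lemma mul_indPos_nonneg {Ω : Type*} (X : Ω → ℝ) (ω : Ω) : 0 ≤ X ω * indPos X ω := by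
  rcases lt_or_ge 0 (X ω) with h | h
  · simpa [indPos_of_pos h] using h.le
  · simp [indPos_of_nonpos h]

lemma le_mul_indPos {Ω : Type*} (X : Ω → ℝ) (ω : Ω) : X ω ≤ X ω * indPos X ω := by
  rcases lt_or_ge 0 (X ω) with h | h
  · simp [indPos_of_pos h]
  · simpa [indPos_of_nonpos h] using h

lemma mul_indPos_le_const_mul {Ω : Type*} {X : Ω → ℝ} {M : ℝ} {ω : Ω} (h : X ω ≤ M) :
    X ω * indPos X ω ≤ M * indPos X ω :=
  mul_le_mul_of_nonneg_right h (indPos_nonneg X ω)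

lemma exists_pos_bound {Ω : Type*} [MeasurableSpace Ω] {X : Ω → ℝ} (hX : X ∈ Bb Ω) :
    ∃ M : ℝ, 0 < M ∧ ∀ ω, |X ω| ≤ M := by
  obtain ⟨M, hM⟩ := hX.2
  exact ⟨max M 1, by positivity, fun ω => (hM ω).trans (le_max_left _ _)⟩

lemma indicator_one_mem_Bb {Ω : Type*} [MeasurableSpace Ω] {A : Set Ω} (hA : MeasurableSet A) :
    Set.indicator A (fun _ => (1 : ℝ)) ∈ Bb Ω :=
  ⟨measurable_const.indicator hA, 1, fun ω => by by_cases h : ω ∈ A <;> simp [h]⟩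

lemma indPos_mem_Bb {Ω : Type*} [MeasurableSpace Ω] {X : Ω → ℝ} (hX : X ∈ Bb Ω) :
    indPos X ∈ Bb Ω :=
  indicator_one_mem_Bb (measurableSet_lt measurable_const hX.1)

lemma const_mul_mem_Bb {Ω : Type*} [MeasurableSpace Ω] {X : Ω → ℝ} (c : ℝ) (hX : X ∈ Bb Ω) :
    (fun ω => c * X ω) ∈ Bb Ω := by
  obtain ⟨M, hM⟩ := hX.2
  refine ⟨hX.1.const_mul c, |c| * M, fun ω => ?_⟩
  rw [abs_mul]
  exact mul_le_mul_of_nonneg_left (hM ω) (abs_nonneg c)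

lemma add_mem_Bb {Ω : Type*} [MeasurableSpace Ω] {X Y : Ω → ℝ} (hX : X ∈ Bb Ω) (hY : Y ∈ Bb Ω) :
    (fun ω => X ω + Y ω) ∈ Bb Ω := by
  obtain ⟨M, hM⟩ := hX.2
  obtain ⟨N, hN⟩ := hY.2
  exact ⟨hX.1.add hY.1, M + N, fun ω => (abs_add_le _ _).trans (add_le_add (hM ω) (hN ω))⟩

lemma sub_mem_Bb {Ω : Type*} [MeasurableSpace Ω] {X Y : Ω → ℝ} (hX : X ∈ Bb Ω) (hY : Y ∈ Bb Ω) :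
    (fun ω => X ω - Y ω) ∈ Bb Ω := by
  simpa [sub_eq_add_neg] using add_mem_Bb hX (const_mul_mem_Bb (-1) hY)

lemma mul_indPos_mem_Bb {Ω : Type*} [MeasurableSpace Ω] {X : Ω → ℝ} (hX : X ∈ Bb Ω) :
    (fun ω => X ω * indPos X ω) ∈ Bb Ω := by
  obtain ⟨M, hM0, hM⟩ := exists_pos_bound hX
  refine ⟨hX.1.mul (indPos_mem_Bb hX).1, M, fun ω => ?_⟩
  rcases lt_or_ge 0 (X ω) with h | h
  · simpa [indPos_of_pos h] using hM ω
  · simpa [indPos_of_nonpos h] using hM0.le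

lemma eq_indPos_of_scaling_invariant {Ω : Type*} [MeasurableSpace Ω] {ρ : (Ω → ℝ) → ℝ}
    (hmono : ∀ X ∈ Bb Ω, ∀ Y ∈ Bb Ω, (∀ ω, X ω ≤ Y ω) → ρ X ≤ ρ Y)
    (hscale : ∀ l : ℝ, 0 < l → ∀ X ∈ Bb Ω, (∀ ω, 0 ≤ X ω) → ρ (fun ω => l * X ω) = ρ X)
    (hpos : ∀ X ∈ Bb Ω, ρ X = ρ (fun ω => X ω * indPos X ω) ∧
      ρ X = sInf ((fun ε => ρ (fun ω => X ω + ε * indPos X ω)) '' Set.Ioi 0))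
    {X : Ω → ℝ} (hX : X ∈ Bb Ω) : ρ X = ρ (indPos X) := by
  obtain ⟨M, hM0, hM⟩ := exists_pos_bound hX
  have hI := indPos_mem_Bb hX
  have hP := mul_indPos_mem_Bb hX
  rw [(hpos X hX).1]
  apply le_antisymm
  · rw [← hscale M hM0 _ hI (indPos_nonneg X)]
    exact hmono _ hP _ (const_mul_mem_Bb M hI) fun ω =>
      mul_indPos_le_const_mul ((le_abs_self _).trans (hM ω))
  · rw [(hpos _ hP).2]
    refine le_csInf (Set.nonempty_Ioi.image _) ?_
    rintro _ ⟨ε, hε, rfl⟩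
    simp only [indPos_mul_indPos]
    rw [← hscale ε hε _ hI (indPos_nonneg X)]
    exact hmono _ (const_mul_mem_Bb ε hI) _ (add_mem_Bb hP (const_mul_mem_Bb ε hI)) fun ω =>
      le_add_of_nonneg_left (mul_indPos_nonneg X ω)

lemma eq_indPos_of_liquidity_invariant {Ω : Type*} [MeasurableSpace Ω] {ρ : (Ω → ℝ) → ℝ}
    (hmono : ∀ X ∈ Bb Ω, ∀ Y ∈ Bb Ω, (∀ ω, X ω ≤ Y ω) → ρ X ≤ ρ Y)
    (hliq : ∀ m : ℝ, 0 < m → ∀ X ∈ Bb Ω, (∀ ω, 0 ≤ X ω) →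
      ρ X = ρ (fun ω => X ω - m * Set.indicator {ω' | X ω' = 0} (fun _ => 1) ω))
    (hilliq : ∀ m : ℝ, 0 < m → ∀ X ∈ Bb Ω, (∀ ω, 0 ≤ X ω) →
      ρ X = ρ (fun ω => X ω + m * indPos X ω))
    {X : Ω → ℝ} (hX : X ∈ Bb Ω) : ρ X = ρ (indPos X) := by
  obtain ⟨M, hM0, hM⟩ := exists_pos_bound hX
  have hI := indPos_mem_Bb hX
  have hP := mul_indPos_mem_Bb hX
  apply le_antisymm
  · rw [hilliq M hM0 _ hI (indPos_nonneg X), indPos_indPos]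
    refine hmono _ hX _ (add_mem_Bb hI (const_mul_mem_Bb M hI)) fun ω => ?_
    have h₁ := le_mul_indPos X ω
    have h₂ := mul_indPos_le_const_mul ((le_abs_self _).trans (hM ω))
    linarith [indPos_nonneg X ω]
  · calc ρ (indPos X)
        ≤ ρ (fun ω => X ω * indPos X ω + 1 * indPos X ω) :=
          hmono _ hI _ (add_mem_Bb hP (const_mul_mem_Bb 1 hI)) fun ω => by
            linarith [mul_indPos_nonneg X ω]
      _ = ρ (fun ω => X ω * indPos X ω) := by
          have h := hilliq 1 one_pos _ hP (mul_indPos_nonneg X)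
          rw [indPos_mul_indPos] at h
          exact h.symm
      _ = _ := hliq M hM0 _ hP (mul_indPos_nonneg X)
      _ ≤ ρ X := by
          refine hmono _ (sub_mem_Bb hP (const_mul_mem_Bb M (indicator_one_mem_Bb
            (measurableSet_eq_fun hP.1 measurable_const)))) _ hX fun ω => ?_
          rcases lt_or_ge 0 (X ω) with h | h
          · simp [indPos_of_pos h, h.ne']
          · simpa [indPos_of_nonpos h] using (abs_le.mp (hM ω)).1

lemma scaling_invariant_of_eq_indPos {Ω : Type*} [MeasurableSpace Ω] {ρ : (Ω → ℝ) → ℝ}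
    (hcap : ∀ X ∈ Bb Ω, ρ X = ρ (indPos X)) :
    (∀ l : ℝ, 0 < l → ∀ X ∈ Bb Ω, (∀ ω, 0 ≤ X ω) → ρ (fun ω => l * X ω) = ρ X) ∧
    (∀ X ∈ Bb Ω, ρ X = ρ (fun ω => X ω * indPos X ω) ∧
      ρ X = sInf ((fun ε => ρ (fun ω => X ω + ε * indPos X ω)) '' Set.Ioi 0)) := by
  refine ⟨fun l hl X hX _ => ?_, fun X hX => ⟨?_, ?_⟩⟩
  · rw [hcap _ (const_mul_mem_Bb l hX), hcap X hX, indPos_const_mul X hl]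
  · rw [hcap X hX, hcap _ (mul_indPos_mem_Bb hX), indPos_mul_indPos]
  · have himage : (fun ε => ρ (fun ω => X ω + ε * indPos X ω)) '' Set.Ioi 0 = {ρ X} := by
      rw [← (Set.nonempty_Ioi (a := (0 : ℝ))).image_const (ρ X)]
      refine Set.image_congr fun ε hε => ?_
      rw [hcap X hX, hcap _ (add_mem_Bb hX (const_mul_mem_Bb ε (indPos_mem_Bb hX))),
        indPos_add_mul_indPos X hε]
    rw [himage, csInf_singleton]

/-- for a default risk measure the following are equivalent:
(i) `ρ(X) = ρ(𝟙_{X>0})` for all `X`;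
(ii) `ρ` is scaling invariant with `ρ(X) = ρ(X⁺) = inf_{ε>0} ρ(X + ε·𝟙_{X>0})`;
(iii) `ρ` is liquidity invariant and illiquidity invariant. -/
theorem capacity_representation_equiv {Ω : Type*} [MeasurableSpace Ω]
    (ρ : (Ω → ℝ) → ℝ) (hρ : IsDefaultRiskMeasure (Bb Ω) ρ) :
    ((∀ X ∈ Bb Ω, ρ X = ρ (indPos X)) ↔
      ((∀ l : ℝ, 0 < l → ∀ X ∈ Bb Ω, (∀ ω, 0 ≤ X ω) →
            ρ (fun ω => l * X ω) = ρ X) ∧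
        (∀ X ∈ Bb Ω,
          ρ X = ρ (fun ω => X ω * indPos X ω) ∧
          ρ X = sInf ((fun ε => ρ (fun ω => X ω + ε * indPos X ω)) '' Set.Ioi 0)))) ∧
    (((∀ l : ℝ, 0 < l → ∀ X ∈ Bb Ω, (∀ ω, 0 ≤ X ω) →
            ρ (fun ω => l * X ω) = ρ X) ∧
        (∀ X ∈ Bb Ω,
          ρ X = ρ (fun ω => X ω * indPos X ω) ∧
          ρ X = sInf ((fun ε => ρ (fun ω => X ω + ε * indPos X ω)) '' Set.Ioi 0))) ↔
      ((∀ m : ℝ, 0 < m → ∀ X ∈ Bb Ω, (∀ ω, 0 ≤ X ω) →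
            ρ X = ρ (fun ω =>
              X ω - m * Set.indicator {ω' | X ω' = 0} (fun _ => 1) ω)) ∧
        (∀ m : ℝ, 0 < m → ∀ X ∈ Bb Ω, (∀ ω, 0 ≤ X ω) →
            ρ X = ρ (fun ω => X ω + m * indPos X ω)))) := by
  obtain ⟨-, hmono, -, -⟩ := hρ
  refine ⟨⟨scaling_invariant_of_eq_indPos, fun h X hX =>
    eq_indPos_of_scaling_invariant hmono h.1 h.2 hX⟩, fun h => ?_, fun h => ?_⟩
  · have hcap : ∀ X ∈ Bb Ω, ρ X = ρ (indPos X) := fun X hX =>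
      eq_indPos_of_scaling_invariant hmono h.1 h.2 hX
    refine ⟨fun m hm X hX _ => ?_, fun m hm X hX _ => ?_⟩
    · rw [hcap X hX, hcap _ (sub_mem_Bb hX (const_mul_mem_Bb m (indicator_one_mem_Bb
        (measurableSet_eq_fun hX.1 measurable_const)))), indPos_sub_indicator_zero X hm]
    · rw [hcap X hX, hcap _ (add_mem_Bb hX (const_mul_mem_Bb m (indPos_mem_Bb hX))),
        indPos_add_mul_indPos X hm]
  · exact scaling_invariant_of_eq_indPos fun X hX =>
      eq_indPos_of_liquidity_invariant hmono h.1 h.2 hX
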